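/- Let φ be a Schwartz function on ℝ^d and α > d (or, in the tensor form used in the paper, α > 1 per coordinate). Then for every k ∈ ℕ_0^d and every locally integrable f on ℝ^d, |2^{|k|_1} ∫_{ℝ^d} (F^{−1}φ)(2^{k_1} y_1, …, 2^{k_d} y_d) f(x − y) dy| ≤ C (ℳ f)(x), where ℳ = M_d ∘ ⋯ ∘ M_1 is the composition of one-dimensional Hardy–Littlewood maximal operators in each coordinate and C depends only on φ and d. -/

import Mathlib

open MeasureTheory ENNReal FourierTransform

/-- The one-dimensional Hardy–Littlewood maximal operator acting in the i-th
coordinate direction, on ℝ≥0∞-valued functions. -/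
noncomputable def dirMaximal {d : ℕ} (i : Fin d) (g : (Fin d → ℝ) → ℝ≥0∞)
    (x : Fin d → ℝ) : ℝ≥0∞ :=
  ⨆ (s : ℝ) (_ : 0 < s),
    (∫⁻ t in Set.Icc (x i - s) (x i + s), g (Function.update x i t)) /
      ENNReal.ofReal (2 * s)

/-- The iterated directional maximal operator ℳ = M_d ∘ ⋯ ∘ M_1 applied to |f|. -/
noncomputable def iterMaximal {d : ℕ} (f : EuclideanSpace ℝ (Fin d) → ℂ) :
    (Fin d → ℝ) → ℝ≥0∞ :=
  (List.finRange d).foldr (fun i g => dirMaximal i g)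
    (fun x => (‖f ((EuclideanSpace.equiv (Fin d) ℝ).symm x)‖₊ : ℝ≥0∞))

/-- Scaled one-dimensional Poisson-type kernel. -/
noncomputable def kerW (k : ℕ) (u : ℝ) : ℝ≥0∞ :=
  ENNReal.ofReal (2 ^ k * (1 + (2 ^ k * u) ^ 2)⁻¹)

lemma kerW_one_dim (k : ℕ) (x : ℝ) (g : ℝ → ℝ≥0∞) (M : ℝ≥0∞)
    (hM : ∀ s : ℝ, 0 < s →
      ∫⁻ t in Set.Icc (x - s) (x + s), g t ≤ ENNReal.ofReal (2 * s) * M) :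
    ∫⁻ t, kerW k (x - t) * g t ≤ 16 * M := by
  let A : ℕ → Set ℝ := fun j =>
    {t | |2 ^ k * (x - t)| ≤ 2 ^ j ∧ (1 + (2 ^ k * (x - t)) ^ 2)⁻¹ ≤ 4 * (1 / 4) ^ j}
  have hAm : ∀ j, MeasurableSet (A j) := by
    intro j
    have h1 : MeasurableSet {t : ℝ | |2 ^ k * (x - t)| ≤ 2 ^ j} :=
      measurableSet_le (by fun_prop) (by fun_prop)
    have h2 : MeasurableSet {t : ℝ | (1 + (2 ^ k * (x - t)) ^ 2)⁻¹ ≤ 4 * (1 / 4) ^ j} :=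
      measurableSet_le (by fun_prop) (by fun_prop)
    exact h1.inter h2
  have hcov : ⋃ j, A j = Set.univ := by
    refine Set.eq_univ_of_forall fun t => Set.mem_iUnion.2 ?_
    set u := 2 ^ k * (x - t) with hu
    have hpos : 0 < 1 + u ^ 2 := by positivity
    rcases le_total |u| 1 with h | h
    · refine ⟨0, ?_, ?_⟩
      · rw [← hu, pow_zero]; exact h
      · rw [← hu]
        have : (1 + u ^ 2)⁻¹ ≤ 1 := inv_le_one_of_one_le₀ (by nlinarith)
        norm_num
        linarith
    · obtain ⟨n, h1, h2⟩ := exists_nat_pow_near h (one_lt_two)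
      refine ⟨n + 1, h2.le, ?_⟩
      rw [← hu]
      have h3 : (4 : ℝ) ^ n ≤ u ^ 2 := by
        have : ((2 : ℝ) ^ n) ^ 2 ≤ |u| ^ 2 := by gcongr
        rw [sq_abs, ← pow_mul, mul_comm, pow_mul] at this
        norm_num at this
        exact this
      calc (1 + u ^ 2)⁻¹ ≤ (4 ^ n)⁻¹ := inv_anti₀ (by positivity) (by linarith)
        _ = 4 * (1 / 4) ^ (n + 1) := by
          rw [pow_succ, one_div, inv_pow]; ring
  have hj : ∀ j, ∫⁻ t in A j, kerW k (x - t) * g t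
      ≤ ENNReal.ofReal (8 * (1 / 2) ^ j) * M := by
    intro j
    have hs : (0 : ℝ) < 2 ^ j / 2 ^ k := by positivity
    calc ∫⁻ t in A j, kerW k (x - t) * g t
        ≤ ∫⁻ t in A j, ENNReal.ofReal (2 ^ k * (4 * (1 / 4) ^ j)) * g t := by
          refine setLIntegral_mono' (hAm j) fun t ht => ?_
          unfold kerW
          gcongr
          exact ht.2
      _ = ENNReal.ofReal (2 ^ k * (4 * (1 / 4) ^ j)) * ∫⁻ t in A j, g t :=
          lintegral_const_mul' _ _ ENNReal.ofReal_ne_top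
      _ ≤ ENNReal.ofReal (2 ^ k * (4 * (1 / 4) ^ j)) *
            ∫⁻ t in Set.Icc (x - 2 ^ j / 2 ^ k) (x + 2 ^ j / 2 ^ k), g t := by
          gcongr
          intro t ht
          have h1 := ht.1
          rw [abs_mul, abs_of_pos (by positivity : (0 : ℝ) < 2 ^ k), mul_comm,
            ← le_div_iff₀ (by positivity), abs_le] at h1
          constructor <;> linarith [h1.1, h1.2]
      _ ≤ ENNReal.ofReal (2 ^ k * (4 * (1 / 4) ^ j)) *
            (ENNReal.ofReal (2 * (2 ^ j / 2 ^ k)) * M) := by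
          gcongr
          exact hM _ hs
      _ = ENNReal.ofReal (8 * (1 / 2) ^ j) * M := by
          rw [← mul_assoc, ← ENNReal.ofReal_mul (by positivity)]
          congr 2
          have : (1 / 4 : ℝ) ^ j * 2 ^ j = (1 / 2) ^ j := by
            rw [← mul_pow]; norm_num
          rw [← this]
          field_simp
          ring
  calc ∫⁻ t, kerW k (x - t) * g t = ∫⁻ t in ⋃ j, A j, kerW k (x - t) * g t := by
        rw [hcov, Measure.restrict_univ]
    _ ≤ ∑' j, ∫⁻ t in A j, kerW k (x - t) * g t := lintegral_iUnion_le _ _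
    _ ≤ ∑' j : ℕ, ENNReal.ofReal (8 * (1 / 2) ^ j) * M := ENNReal.tsum_le_tsum hj
    _ = 16 * M := by
        rw [ENNReal.tsum_mul_right, ← ENNReal.ofReal_tsum_of_nonneg
          (fun n => by positivity) (summable_geometric_two.mul_left 8),
          tsum_mul_left, tsum_geometric_two]
        norm_num

lemma foldr_cons {d : ℕ} (l : List (Fin d)) (G : (Fin (d + 1) → ℝ) → ℝ≥0∞) (t : ℝ)
    (x : Fin d → ℝ) :
    ((l.map Fin.succ).foldr (fun i g => dirMaximal i g) G) (Fin.cons t x)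
      = (l.foldr (fun i g => dirMaximal i g) (fun z => G (Fin.cons t z))) x := by
  induction l generalizing x with
  | nil => rfl
  | cons i l ih =>
    simp only [List.map_cons, List.foldr_cons, dirMaximal, Fin.cons_succ, ← Fin.cons_update, ih]

lemma kerW_multi (d : ℕ) (k : Fin d → ℕ) (G : (Fin d → ℝ) → ℝ≥0∞) (x : Fin d → ℝ) :
    ∫⁻ z, (∏ i, kerW (k i) (x i - z i)) * G z
      ≤ 16 ^ d * ((List.finRange d).foldr (fun i g => dirMaximal i g) G) x := by
  induction d with
  | zero =>
    rw [volume_pi, Measure.pi_of_empty _ x]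
    simp
  | succ d ih =>
    rw [← ((volume_preserving_piFinSuccAbove (fun _ : Fin (d + 1) => ℝ) 0).symm).lintegral_comp_emb
      (MeasurableEquiv.measurableEmbedding _), Measure.volume_eq_prod]
    refine (lintegral_prod_le _).trans ?_
    set H := ((List.finRange d).map Fin.succ).foldr (fun i g => dirMaximal i g) G with hH
    have hinner : ∀ t : ℝ, (∫⁻ y : Fin d → ℝ,
        (∏ i, kerW (k i) (x i - (Fin.cons t y : Fin (d + 1) → ℝ) i)) * G (Fin.cons t y))
        ≤ 16 ^ d * (kerW (k 0) (x 0 - t) * H (Function.update x 0 t)) := by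
      intro t
      have := ih (fun i => k i.succ) (fun z => G (Fin.cons t z)) (fun i => x i.succ)
      rw [← foldr_cons] at this
      simp only [Fin.prod_univ_succ, Fin.cons_zero, Fin.cons_succ, mul_assoc]
      rw [lintegral_const_mul' (kerW (k 0) (x 0 - t)) _ ENNReal.ofReal_ne_top]
      have hx : Function.update x 0 t = Fin.cons t (fun i => x i.succ) := by
        ext i
        refine Fin.cases ?_ (fun i => ?_) i <;> simp
      rw [hx, mul_left_comm]
      gcongr
    calc _ ≤ ∫⁻ t : ℝ, 16 ^ d * (kerW (k 0) (x 0 - t) * H (Function.update x 0 t)) := by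
          refine lintegral_mono fun t => ?_
          refine le_trans (le_of_eq ?_) (hinner t)
          refine lintegral_congr fun y => ?_
          simp [MeasurableEquiv.piFinSuccAbove, Fin.insertNthEquiv]
      _ = 16 ^ d * ∫⁻ t : ℝ, (kerW (k 0) (x 0 - t) * H (Function.update x 0 t)) :=
          lintegral_const_mul' _ _ (by simp)
      _ ≤ 16 ^ d * (16 * dirMaximal 0 H x) := by
          gcongr
          refine kerW_one_dim _ _ _ _ fun s hs => ?_
          rw [mul_comm, ← ENNReal.div_le_iff (by simpa using hs) ENNReal.ofReal_ne_top]
          exact le_iSup₂ (f := fun (s : ℝ) (_ : 0 < s) =>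
            (∫⁻ t in Set.Icc (x 0 - s) (x 0 + s), H (Function.update x 0 t)) /
              ENNReal.ofReal (2 * s)) s hs
      _ = _ := by
          rw [← mul_assoc, ← pow_succ, List.finRange_succ, List.foldr_cons]

lemma schwartz_bound (d : ℕ) (ψ : SchwartzMap (EuclideanSpace ℝ (Fin d)) ℂ) :
    ∃ C : ℝ, 0 ≤ C ∧ ∀ z, ‖ψ z‖ ≤ C * ∏ i, (1 + (z i) ^ 2)⁻¹ := by
  refine ⟨2 ^ (2 * d) * (Finset.Iic ((2 * d, 0) : ℕ × ℕ)).sup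
    (fun m => SchwartzMap.seminorm ℝ m.1 m.2) ψ, by positivity, fun z => ?_⟩
  have h := SchwartzMap.one_add_le_sup_seminorm_apply (𝕜 := ℝ) (m := (2 * d, 0)) (k := 2 * d)
    (n := 0) le_rfl le_rfl ψ z
  rw [norm_iteratedFDeriv_zero] at h
  rw [Finset.prod_inv_distrib, ← div_eq_mul_inv, le_div_iff₀ (by positivity), mul_comm]
  refine le_trans ?_ h
  gcongr
  calc ∏ i, (1 + (z i) ^ 2) ≤ ∏ _i : Fin d, (1 + ‖z‖) ^ 2 := by
        refine Finset.prod_le_prod (fun i _ => by positivity) fun i _ => ?_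
        have h1 : ‖z i‖ ≤ ‖z‖ := PiLp.norm_apply_le z i
        have h2 : (z i) ^ 2 ≤ ‖z‖ ^ 2 := by
          rw [← sq_abs]
          exact pow_le_pow_left₀ (abs_nonneg _) h1 2
        nlinarith [norm_nonneg z]
    _ = (1 + ‖z‖) ^ (2 * d) := by simp [pow_mul]

lemma core_bound (d : ℕ) (Ψ : EuclideanSpace ℝ (Fin d) → ℂ) (C : ℝ) (hC0 : 0 ≤ C)
    (hC : ∀ z, ‖Ψ z‖ ≤ C * ∏ i, (1 + (z i) ^ 2)⁻¹) (k : Fin d → ℕ)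
    (f : EuclideanSpace ℝ (Fin d) → ℂ) (x : EuclideanSpace ℝ (Fin d)) :
    ENNReal.ofReal (2 ^ (∑ i, k i : ℕ)) * ‖∫ y : EuclideanSpace ℝ (Fin d),
                Ψ ((EuclideanSpace.equiv (Fin d) ℝ).symm
                    (fun i => 2 ^ (k i) * y i)) * f (x - y)‖ₑ ≤
      ENNReal.ofReal C * ∫⁻ z : Fin d → ℝ, (∏ i, kerW (k i) (x i - z i)) *
        (‖f ((EuclideanSpace.equiv (Fin d) ℝ).symm z)‖₊ : ℝ≥0∞) := by
  have hpt : ∀ y : EuclideanSpace ℝ (Fin d), ENNReal.ofReal (2 ^ (∑ i, k i : ℕ)) *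
      ‖Ψ ((EuclideanSpace.equiv (Fin d) ℝ).symm (fun i => 2 ^ (k i) * y i))‖ₑ
      ≤ ENNReal.ofReal C * ∏ i, kerW (k i) (y i) := by
    intro y
    unfold kerW
    rw [← ENNReal.ofReal_prod_of_nonneg (fun i _ => by positivity), ← ofReal_norm,
      ← ENNReal.ofReal_mul (by positivity), ← ENNReal.ofReal_mul hC0]
    refine ENNReal.ofReal_le_ofReal ?_
    rw [Finset.prod_mul_distrib, Finset.prod_pow_eq_pow_sum, mul_left_comm]
    gcongr
    exact hC _
  calc ENNReal.ofReal (2 ^ (∑ i, k i : ℕ)) * ‖∫ y : EuclideanSpace ℝ (Fin d),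
                Ψ ((EuclideanSpace.equiv (Fin d) ℝ).symm
                    (fun i => 2 ^ (k i) * y i)) * f (x - y)‖ₑ ≤ ENNReal.ofReal (2 ^ (∑ i, k i : ℕ)) * ∫⁻ y : EuclideanSpace ℝ (Fin d),
        ‖Ψ ((EuclideanSpace.equiv (Fin d) ℝ).symm
                    (fun i => 2 ^ (k i) * y i)) * f (x - y)‖ₑ := by
        gcongr
        exact enorm_integral_le_lintegral_enorm _
    _ = ∫⁻ y : EuclideanSpace ℝ (Fin d), ENNReal.ofReal (2 ^ (∑ i, k i : ℕ)) *
        ‖Ψ ((EuclideanSpace.equiv (Fin d) ℝ).symm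
                    (fun i => 2 ^ (k i) * y i)) * f (x - y)‖ₑ :=
        (lintegral_const_mul' _ _ ENNReal.ofReal_ne_top).symm
    _ ≤ ∫⁻ y : EuclideanSpace ℝ (Fin d),
          ENNReal.ofReal C * ((∏ i, kerW (k i) (y i)) * ‖f (x - y)‖ₑ) := by
        refine lintegral_mono fun y => ?_
        rw [enorm_mul, ← mul_assoc, ← mul_assoc]
        exact mul_le_mul_left (hpt y) _
    _ = ENNReal.ofReal C * ∫⁻ y : EuclideanSpace ℝ (Fin d),
          (∏ i, kerW (k i) (y i)) * ‖f (x - y)‖ₑ :=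
        lintegral_const_mul' _ _ ENNReal.ofReal_ne_top
    _ = ENNReal.ofReal C * ∫⁻ z : EuclideanSpace ℝ (Fin d),
          (∏ i, kerW (k i) (x i - z i)) * ‖f z‖ₑ := by
        congr 1
        rw [← lintegral_sub_left_eq_self _ x]
        simp
    _ = _ := by
        congr 1
        rw [← (PiLp.volume_preserving_toLp (Fin d)).lintegral_comp_emb
          (MeasurableEquiv.toLp 2 _).measurableEmbedding]
        rfl

theorem stmt_10 (d : ℕ) (φ : SchwartzMap (EuclideanSpace ℝ (Fin d)) ℂ) :
    ∃ C : ℝ≥0∞, C < ∞ ∧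
      ∀ (k : Fin d → ℕ) (f : EuclideanSpace ℝ (Fin d) → ℂ),
        LocallyIntegrable f volume →
        ∀ x : EuclideanSpace ℝ (Fin d),
          (‖(2 : ℝ) ^ (∑ i, k i : ℕ) *
              ∫ y : EuclideanSpace ℝ (Fin d),
                (𝓕⁻ (⇑φ)) ((EuclideanSpace.equiv (Fin d) ℝ).symm
                    (fun i => 2 ^ (k i) * y i)) * f (x - y)‖₊ : ℝ≥0∞)
            ≤ C * iterMaximal f x := by
  obtain ⟨C, hC0, hC⟩ := schwartz_bound d (𝓕⁻ φ)
  rw [SchwartzMap.fourierInv_coe] at hC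
  refine ⟨ENNReal.ofReal C * 16 ^ d, ENNReal.mul_lt_top ENNReal.ofReal_lt_top (by simp), ?_⟩
  intro k f _ x
  rw [mul_assoc]
  refine le_trans ?_ (mul_le_mul_right (kerW_multi d k
    (fun z => (‖f ((EuclideanSpace.equiv (Fin d) ℝ).symm z)‖₊ : ℝ≥0∞)) x) _)
  refine le_trans (le_of_eq ?_) (core_bound d _ C hC0 hC k f x)
  rw [← enorm_eq_nnnorm, enorm_mul]
  congr 1
  rw [← ofReal_norm]
  simp
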